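/- Let n, k be positive integers with k odd, and let M(n,k,p) denote the maximum over all k-wise independent distributions of n {0,1}-valued random variables with P(X_i = 1) = p of the probability P(X_1 = ... = X_n = 1). Then M(n, k, p) = p · M(n-1, k-1, p). -/

import Mathlib

open Finset

/-- The set of achievable values of `P(all bits are 1)` over all `k`-wise independent
distributions of `n` bits with marginals `p`. -/
def andProbs (n k : ℕ) (p : ℝ) : Set ℝ :=
  {t | ∃ q : (Fin n → Bool) → ℝ,
    (∀ v, 0 ≤ q v) ∧ (∑ v, q v) = 1 ∧
    (∀ S : Finset (Fin n), S.card ≤ k →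
      (∑ v ∈ Finset.univ.filter (fun v : Fin n → Bool => ∀ i ∈ S, v i = true), q v)
        = p ^ S.card) ∧
    t = q (fun _ => true)}

open Polynomial in
/-- The moments up to order `d` of a finite weighting on `0, …, n` can be reproduced by a weighting
supported on any set of more than `d` nodes. -/
theorem exists_quadrature (W : ℕ → ℝ) (n d : ℕ) (Z : Finset ℕ) (hZ : Z ⊆ range (n + 1))
    (hd : d < #Z) :
    ∃ ν : ℕ → ℝ, (∀ j ∉ Z, ν j = 0) ∧ ∀ f : ℝ[X], f.natDegree ≤ d →
      ∑ j ∈ range (n + 1), ν j * f.eval (j : ℝ) = ∑ j ∈ range (n + 1), W j * f.eval (j : ℝ) := by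
  have hinj : Set.InjOn (fun j : ℕ => (j : ℝ)) Z := Nat.cast_injective.injOn
  refine ⟨fun z => if z ∈ Z then ∑ j ∈ range (n + 1), W j *
    (Lagrange.basis Z (fun j : ℕ => (j : ℝ)) z).eval (j : ℝ) else 0, fun j hj => by simp [hj], ?_⟩
  intro f hf
  have hdeg : f.degree < #Z :=
    lt_of_le_of_lt degree_le_natDegree (by exact_mod_cast lt_of_le_of_lt hf hd)
  have hf' := Lagrange.eq_interpolate hinj hdeg
  have heval : ∀ x : ℝ, f.eval x = ∑ z ∈ Z, f.eval (z : ℝ) *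
      (Lagrange.basis Z (fun j : ℕ => (j : ℝ)) z).eval x := by
    intro x
    conv_lhs => rw [hf', Lagrange.interpolate_apply]
    simp [eval_finsetSum]
  have hL : ∑ j ∈ range (n + 1), W j * f.eval (j : ℝ) = ∑ z ∈ Z, (∑ j ∈ range (n + 1), W j *
      (Lagrange.basis Z (fun j : ℕ => (j : ℝ)) z).eval (j : ℝ)) * f.eval (z : ℝ) := by
    simp_rw [sum_mul]
    rw [sum_comm]
    refine sum_congr rfl fun j _ => ?_
    rw [heval, mul_sum]
    exact sum_congr rfl fun z _ => by ring
  rw [hL]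
  simp only [ite_mul, zero_mul]
  rw [← sum_filter, filter_mem_eq_inter, inter_eq_right.mpr hZ]

open Polynomial in
/-- The polynomial vanishing at `0` and on `T`, normalized to take the value `1` at `n`. -/
noncomputable def nodePoly (n : ℕ) (T : Finset ℕ) : ℝ[X] :=
  C ((n * ∏ t ∈ T, ((n : ℝ) - t))⁻¹) * (X * ∏ t ∈ T, (X - C (t : ℝ)))

theorem nodePoly_eval (n : ℕ) (T : Finset ℕ) (x : ℝ) :
    (nodePoly n T).eval x =
      (n * ∏ t ∈ T, ((n : ℝ) - t))⁻¹ * (x * ∏ t ∈ T, (x - t)) := by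
  simp [nodePoly, Polynomial.eval_prod]

open Polynomial in
theorem natDegree_prod_X_sub_C_le (T : Finset ℕ) :
    (∏ t ∈ T, (X - C (t : ℝ))).natDegree ≤ #T :=
  (natDegree_finsetProd_X_sub_C_eq_card T _).le

open Polynomial in
theorem nodePoly_natDegree_le (n : ℕ) (T : Finset ℕ) : (nodePoly n T).natDegree ≤ #T + 1 := by
  refine (natDegree_C_mul_le _ _).trans (natDegree_mul_le.trans ?_)
  have := natDegree_prod_X_sub_C_le T
  have := natDegree_X_le (R := ℝ)
  omega

theorem prod_natCast_sub_pos {T : Finset ℕ} {n : ℕ} (hT : ∀ t ∈ T, t < n) :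
    0 < ∏ t ∈ T, ((n : ℝ) - t) :=
  prod_pos fun t ht => sub_pos.mpr (by exact_mod_cast hT t ht)

theorem nodePoly_eval_self {T : Finset ℕ} {n : ℕ} (hn : 0 < n) (hT : ∀ t ∈ T, t < n) :
    (nodePoly n T).eval (n : ℝ) = 1 := by
  rw [nodePoly_eval]
  have := prod_natCast_sub_pos hT
  have : (0 : ℝ) < n := by exact_mod_cast hn
  exact inv_mul_cancel₀ (by positivity)

theorem nodePoly_eval_mem {T : Finset ℕ} {n t : ℕ} (ht : t ∈ T) :
    (nodePoly n T).eval (t : ℝ) = 0 := by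
  have h : ∏ s ∈ T, ((t : ℝ) - s) = 0 := prod_eq_zero ht (sub_self _)
  rw [nodePoly_eval, h, mul_zero, mul_zero]

theorem nodePoly_eval_zero (n : ℕ) (T : Finset ℕ) : (nodePoly n T).eval ((0 : ℕ) : ℝ) = 0 := by
  simp [nodePoly_eval]

/-- `T` is an even-gap subset of `1, …, n - 1`: its node polynomial is nonnegative there. -/
def EvenGaps (n : ℕ) (T : Finset ℕ) : Prop :=
  (∀ t ∈ T, 1 ≤ t ∧ t < n) ∧ ∀ j : ℕ, 1 ≤ j → j ≤ n → 0 ≤ ∏ t ∈ T, ((j : ℝ) - t)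

theorem prod_natCast_sub_ne_zero {T : Finset ℕ} {j : ℕ} (hj : j ∉ T) :
    ∏ t ∈ T, ((j : ℝ) - t) ≠ 0 :=
  prod_ne_zero_iff.mpr fun t ht => sub_ne_zero.mpr fun h => hj (by rwa [Nat.cast_injective h])

theorem EvenGaps.prod_pos {n : ℕ} {T : Finset ℕ} (hT : EvenGaps n T) {j : ℕ} (h1 : 1 ≤ j)
    (hn : j ≤ n) (hj : j ∉ T) : 0 < ∏ t ∈ T, ((j : ℝ) - t) :=
  (hT.2 j h1 hn).lt_of_ne (prod_natCast_sub_ne_zero hj).symm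

theorem EvenGaps.nodePoly_nonneg {n : ℕ} {T : Finset ℕ} (hT : EvenGaps n T) {j : ℕ}
    (hn : j ≤ n) : 0 ≤ (nodePoly n T).eval (j : ℝ) := by
  rcases Nat.eq_zero_or_pos j with rfl | h1
  · rw [nodePoly_eval_zero]
  rw [nodePoly_eval]
  have := prod_natCast_sub_pos fun t ht => (hT.1 t ht).2
  have := hT.2 j h1 hn
  positivity

theorem EvenGaps.nodePoly_pos {n : ℕ} {T : Finset ℕ} (hT : EvenGaps n T) {j : ℕ} (h1 : 1 ≤ j)
    (hn : j ≤ n) (hj : j ∉ T) : 0 < (nodePoly n T).eval (j : ℝ) := by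
  rw [nodePoly_eval]
  have := prod_natCast_sub_pos fun t ht => (hT.1 t ht).2
  have := hT.prod_pos h1 hn hj
  have : (0 : ℝ) < j := by exact_mod_cast h1
  have : (0 : ℝ) < n := by exact_mod_cast (h1.trans hn)
  positivity

/-- Removing a node `i` from an even-gap set, either it can be exchanged for another node, or the
remaining nodes together with `n` determine a polynomial of constant sign. -/
theorem EvenGaps.exchange {n : ℕ} {T : Finset ℕ} (hT : EvenGaps n T) {i : ℕ} (hi : i ∈ T) :
    (∃ e ∉ T, EvenGaps n (insert e (T.erase i))) ∨
    ∃ c : ℝ, (∀ j : ℕ, 1 ≤ j → j ≤ n → 0 ≤ c * (((n : ℝ) - j) * ∏ t ∈ T.erase i, ((j : ℝ) - t))) ∧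
      0 < c * (((n : ℝ) - i) * ∏ t ∈ T.erase i, ((i : ℝ) - t)) := by
  set Q : ℕ → ℝ := fun j => ∏ t ∈ T.erase i, ((j : ℝ) - t) with hQ
  have hQT : ∀ j : ℕ, ((j : ℝ) - i) * Q j = ∏ t ∈ T, ((j : ℝ) - t) := fun j =>
    mul_prod_erase T (fun t : ℕ => (j : ℝ) - t) hi
  have hi1 := hT.1 i hi
  have hin : (0 : ℝ) < (n : ℝ) - i := sub_pos.mpr (by exact_mod_cast hi1.2)
  have hQi : Q i ≠ 0 := prod_natCast_sub_ne_zero (notMem_erase i T)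
  have hzero : ∀ j ∈ T, j ≠ i → Q j = 0 := fun j hj hji =>
    prod_eq_zero (mem_erase.mpr ⟨hji, hj⟩) (sub_self _)
  have hgt : ∀ j : ℕ, i < j → j ≤ n → 0 ≤ Q j := by
    intro j hij hjn
    have h := hT.2 j (by omega) hjn
    rw [← hQT] at h
    exact nonneg_of_mul_nonneg_right h (sub_pos.mpr (by exact_mod_cast hij))
  have hlt : ∀ j : ℕ, 1 ≤ j → j < i → Q j ≤ 0 := by
    intro j hj hji
    have h := hT.2 j hj (by omega)
    rw [← hQT] at h
    have : (j : ℝ) - i < 0 := sub_neg.mpr (by exact_mod_cast hji)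
    nlinarith
  have hexch : ∀ e ∉ T, 1 ≤ e → e < n →
      (∀ j : ℕ, 1 ≤ j → j ≤ n → 0 ≤ ((j : ℝ) - e) * Q j) → EvenGaps n (insert e (T.erase i)) := by
    intro e heT he1 hen h
    refine ⟨fun t ht => ?_, fun j hj hjn => ?_⟩
    · rcases mem_insert.mp ht with rfl | ht
      · exact ⟨he1, hen⟩
      · exact hT.1 t (mem_of_mem_erase ht)
    · rw [prod_insert fun h => heT (mem_of_mem_erase h)]
      exact h j hj hjn
  rcases hQi.lt_or_gt with hneg | hpos
  · by_cases hex : ∃ e, i < e ∧ e < n ∧ e ∉ T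
    · left
      classical
      obtain ⟨hie, hen, heT⟩ := Nat.find_spec hex
      have hmin := fun e (h : e < Nat.find hex) => Nat.find_min hex h
      set e := Nat.find hex
      refine ⟨e, heT, hexch e heT (by omega) hen fun j hj hjn => ?_⟩
      rcases lt_or_ge j e with hje | hje
      · have hje' : (j : ℝ) - e ≤ 0 := sub_nonpos.mpr (by exact_mod_cast hje.le)
        refine mul_nonneg_of_nonpos_of_nonpos hje' ?_
        rcases lt_trichotomy j i with h | h | h
        · exact hlt j hj h
        · rw [h]; exact hneg.le
        · have := hmin j hje
          rw [hzero j (by by_contra hc; exact this ⟨h, by omega, hc⟩) h.ne']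
      · exact mul_nonneg (sub_nonneg.mpr (by exact_mod_cast hje)) (hgt j (by omega) hjn)
    · right
      push Not at hex
      refine ⟨-1, fun j hj hjn => ?_, by nlinarith⟩
      rcases hjn.eq_or_lt with rfl | hjn
      · simp
      have h1 : (0 : ℝ) < (n : ℝ) - j := sub_pos.mpr (by exact_mod_cast hjn)
      have h2 : Q j ≤ 0 := by
        rcases lt_trichotomy j i with h | h | h
        · exact hlt j hj h
        · rw [h]; exact hneg.le
        · rw [hzero j (hex j h hjn) h.ne']
      change 0 ≤ -1 * (((n : ℝ) - j) * Q j)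
      nlinarith
  · by_cases hex : ∃ e, 1 ≤ e ∧ e < i ∧ e ∉ T
    · left
      classical
      obtain ⟨e₀, he₀, he₀i, he₀T⟩ := hex
      obtain ⟨e, he, hmax⟩ := exists_max_image ((Ico 1 i).filter (· ∉ T)) id
        ⟨e₀, by simp [he₀, he₀i, he₀T]⟩
      simp only [mem_filter, mem_Ico, id] at he hmax
      obtain ⟨⟨he1, hei⟩, heT⟩ := he
      refine ⟨e, heT, hexch e heT he1 (by omega) fun j hj hjn => ?_⟩
      rcases lt_or_ge e j with hje | hje
      · refine mul_nonneg (sub_nonneg.mpr (by exact_mod_cast hje.le)) ?_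
        rcases lt_trichotomy j i with h | h | h
        · rw [hzero j (by by_contra hc; exact absurd (hmax j ⟨⟨hj, h⟩, hc⟩) (by omega)) h.ne]
        · rw [h]; exact hpos.le
        · exact hgt j h hjn
      · exact mul_nonneg_of_nonpos_of_nonpos (sub_nonpos.mpr (by exact_mod_cast hje))
          (hlt j hj (by omega))
    · right
      push Not at hex
      refine ⟨1, fun j hj hjn => ?_, by rw [one_mul]; exact mul_pos hin hpos⟩
      rw [one_mul]
      refine mul_nonneg (sub_nonneg.mpr (by exact_mod_cast hjn)) ?_
      rcases lt_trichotomy j i with h | h | h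
      · exact (hzero j (hex j hj h) h.ne).ge
      · change 0 ≤ Q j
        rw [h]; exact hpos.le
      · exact hgt j h hjn

open Polynomial in
/-- Every nonnegative weighting on `0, …, n` has, for odd `2 * m + 1 ≤ n`, a representation with the
same moments up to order `2 * m + 1` supported on `0`, `n` and an even-gap set of size `2 * m`. -/
theorem exists_principal_representation (W : ℕ → ℝ) (hW : ∀ j, 0 ≤ W j) {n m : ℕ}
    (hm : 2 * m + 1 ≤ n) :
    ∃ (ν : ℕ → ℝ) (T : Finset ℕ), (∀ j, 0 ≤ ν j) ∧ EvenGaps n T ∧ #T = 2 * m ∧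
      (∀ f : ℝ[X], f.natDegree ≤ 2 * m + 1 →
        ∑ j ∈ range (n + 1), ν j * f.eval (j : ℝ) = ∑ j ∈ range (n + 1), W j * f.eval (j : ℝ)) ∧
      ν n = ∑ j ∈ range (n + 1), W j * (nodePoly n T).eval (j : ℝ) := by
  classical
  set L : ℝ[X] → ℝ := fun f => ∑ j ∈ range (n + 1), W j * f.eval (j : ℝ) with hL
  have hne : (((Icc 1 (n - 1)).powersetCard (2 * m)).filter (EvenGaps n)).Nonempty := by
    refine ⟨Icc 1 (2 * m), mem_filter.mpr ⟨mem_powersetCard.mpr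
      ⟨Icc_subset_Icc_right (by omega), by simp⟩, fun t ht => ?_, fun j hj hjn => ?_⟩⟩
    · have := mem_Icc.mp ht
      omega
    · rcases le_or_gt j (2 * m) with h | h
      · exact (prod_eq_zero (mem_Icc.mpr ⟨hj, h⟩) (sub_self _)).ge
      · refine (prod_natCast_sub_pos fun t ht => ?_).le
        exact (mem_Icc.mp ht).2.trans_lt h
  obtain ⟨T, hT, hmin⟩ := exists_min_image _ (fun T => L (nodePoly n T)) hne
  obtain ⟨hT1, hTe⟩ := mem_filter.mp hT
  have hcard : #T = 2 * m := (mem_powersetCard.mp hT1).2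
  have h0T : 0 ∉ T := fun h => by have := hTe.1 0 h; omega
  have hnT : n ∉ T := fun h => by have := hTe.1 n h; omega
  have h0nT : 0 ∉ insert n T := by simp [h0T]; omega
  have hZ : insert 0 (insert n T) ⊆ range (n + 1) := by
    intro t ht
    simp only [mem_insert] at ht
    rcases ht with rfl | rfl | ht
    · simp
    · simp
    · have := hTe.1 t ht
      simp; omega
  obtain ⟨ν, hν0, hν⟩ := exists_quadrature W n (2 * m + 1) (insert 0 (insert n T)) hZ
    (by rw [card_insert_of_notMem h0nT, card_insert_of_notMem hnT]; omega)
  have hpick : ∀ z ∈ insert 0 (insert n T), ∀ f : ℝ[X], f.natDegree ≤ 2 * m + 1 →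
      (∀ y ∈ insert 0 (insert n T), y ≠ z → f.eval (y : ℝ) = 0) →
      ν z * f.eval (z : ℝ) = L f := by
    intro z hz f hf hvan
    refine Eq.trans ?_ (hν f hf)
    refine (sum_eq_single_of_mem (f := fun j : ℕ => ν j * f.eval (j : ℝ)) z (hZ hz)
      fun y _ hyz => ?_).symm
    by_cases hy : y ∈ insert 0 (insert n T)
    · rw [hvan y hy hyz, mul_zero]
    · rw [hν0 y hy, zero_mul]
  have hνn : ν n = L (nodePoly n T) := by
    rw [← hpick n (by simp) (nodePoly n T) (by rw [← hcard]; exact nodePoly_natDegree_le n T),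
      nodePoly_eval_self (by omega) fun t ht => (hTe.1 t ht).2, mul_one]
    intro y hy hyn
    simp only [mem_insert, hyn, false_or] at hy
    rcases hy with rfl | hy
    · exact nodePoly_eval_zero n T
    · exact nodePoly_eval_mem hy
  have hLnn : ∀ f : ℝ[X], (∀ j : ℕ, j ≤ n → 0 ≤ f.eval (j : ℝ)) → 0 ≤ L f := fun f hf =>
    sum_nonneg fun j hj => mul_nonneg (hW j) (hf j (by simpa [Nat.lt_succ_iff] using hj))
  refine ⟨ν, T, fun z => ?_, hTe, hcard, hν, hνn⟩
  by_cases hz : z ∈ insert 0 (insert n T)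
  swap
  · exact (hν0 z hz).ge
  suffices h : ∃ f : ℝ[X], f.natDegree ≤ 2 * m + 1 ∧
      (∀ y ∈ insert 0 (insert n T), y ≠ z → f.eval (y : ℝ) = 0) ∧ 0 < f.eval (z : ℝ) ∧ 0 ≤ L f by
    obtain ⟨f, hf, hvan, hpos, hLf⟩ := h
    rw [← hpick z hz f hf hvan] at hLf
    exact nonneg_of_mul_nonneg_left hLf hpos
  have hz' := hz
  simp only [mem_insert] at hz'
  rcases hz' with rfl | rfl | hzT
  · refine ⟨(C (n : ℝ) - X) * ∏ t ∈ T, (X - C (t : ℝ)), ?_, ?_, ?_, hLnn _ ?_⟩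
    · refine natDegree_mul_le.trans ?_
      have h1 := natDegree_prod_X_sub_C_le T
      have h2 : (C (n : ℝ) - X).natDegree ≤ 1 := by compute_degree
      omega
    · intro y hy hy0
      simp only [mem_insert, hy0, false_or] at hy
      rcases hy with rfl | hy
      · simp
      · simp only [eval_mul, eval_prod, eval_sub, eval_X, eval_C]
        rw [prod_eq_zero hy (sub_self _), mul_zero]
    · simp only [eval_mul, eval_prod, eval_sub, eval_X, eval_C, Nat.cast_zero, zero_sub, sub_zero]
      rw [prod_neg, hcard, pow_mul]
      have : (0 : ℝ) < ∏ t ∈ T, (t : ℝ) :=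
        Finset.prod_pos fun t ht => by exact_mod_cast (hTe.1 t ht).1
      have : (0 : ℝ) < n := by exact_mod_cast (by omega : 0 < n)
      norm_num
      positivity
    · intro j hjn
      simp only [eval_mul, eval_prod, eval_sub, eval_X, eval_C]
      refine mul_nonneg (sub_nonneg.mpr (by exact_mod_cast hjn)) ?_
      rcases Nat.eq_zero_or_pos j with rfl | hj
      · simp only [Nat.cast_zero, zero_sub]
        rw [prod_neg, hcard, pow_mul]
        norm_num
        exact prod_nonneg fun t _ => by positivity
      · exact hTe.2 j hj hjn
  · refine ⟨nodePoly z T, by rw [← hcard]; exact nodePoly_natDegree_le z T, ?_, ?_,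
      hLnn _ fun j hj => hTe.nodePoly_nonneg hj⟩
    · intro y hy hyn
      simp only [mem_insert, hyn, false_or] at hy
      rcases hy with rfl | hy
      · exact nodePoly_eval_zero z T
      · exact nodePoly_eval_mem hy
    · rw [nodePoly_eval_self (by omega) fun t ht => (hTe.1 t ht).2]
      exact one_pos
  · rcases hTe.exchange hzT with ⟨e, heT, hT'⟩ | ⟨c, hc, hcz⟩
    · have heE : e ∉ T.erase z := fun h => heT (mem_of_mem_erase h)
      have hze : z ≠ e := fun h => heT (h ▸ hzT)
      have hzT' : z ∉ insert e (T.erase z) := by simp [hze]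
      have hcard' : #(insert e (T.erase z)) = 2 * m := by
        rw [card_insert_of_notMem heE, card_erase_add_one hzT, hcard]
      refine ⟨nodePoly n (insert e (T.erase z)) - nodePoly n T, ?_, ?_, ?_, ?_⟩
      · refine (natDegree_sub_le _ _).trans (max_le ?_ ?_)
        · rw [← hcard']; exact nodePoly_natDegree_le _ _
        · rw [← hcard]; exact nodePoly_natDegree_le _ _
      · intro y hy hyz
        rw [eval_sub]
        simp only [mem_insert] at hy
        rcases hy with rfl | rfl | hy
        · rw [nodePoly_eval_zero, nodePoly_eval_zero, sub_zero]
        · rw [nodePoly_eval_self (by omega) fun t ht => (hT'.1 t ht).2,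
            nodePoly_eval_self (by omega) fun t ht => (hTe.1 t ht).2, sub_self]
        · rw [nodePoly_eval_mem hy, nodePoly_eval_mem
            (mem_insert_of_mem (mem_erase.mpr ⟨hyz, hy⟩)), sub_zero]
      · rw [eval_sub, nodePoly_eval_mem hzT, sub_zero]
        exact hT'.nodePoly_pos (hTe.1 z hzT).1 (hTe.1 z hzT).2.le hzT'
      · have h := hmin (insert e (T.erase z)) (mem_filter.mpr ⟨mem_powersetCard.mpr
          ⟨fun t ht => mem_Icc.mpr ⟨(hT'.1 t ht).1, by have := (hT'.1 t ht).2; omega⟩, hcard'⟩, hT'⟩)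
        have hsub : L (nodePoly n (insert e (T.erase z)) - nodePoly n T) =
            L (nodePoly n (insert e (T.erase z))) - L (nodePoly n T) := by
          simp only [hL, eval_sub, mul_sub, sum_sub_distrib]
        rw [hsub]
        exact sub_nonneg.mpr h
    · have hev : ∀ x : ℝ, (C c * (X * ((C (n : ℝ) - X) * ∏ t ∈ T.erase z, (X - C (t : ℝ))))).eval x
          = x * (c * ((n - x) * ∏ t ∈ T.erase z, (x - t))) := by
        intro x
        simp only [eval_mul, eval_prod, eval_sub, eval_X, eval_C]
        ring
      refine ⟨C c * (X * ((C (n : ℝ) - X) * ∏ t ∈ T.erase z, (X - C (t : ℝ)))), ?_, ?_, ?_,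
        hLnn _ ?_⟩
      · refine (natDegree_C_mul_le _ _).trans (natDegree_mul_le.trans ?_)
        have h0 := natDegree_X_le (R := ℝ)
        have h1 := natDegree_prod_X_sub_C_le (T.erase z)
        have h2 : (C (n : ℝ) - X).natDegree ≤ 1 := by compute_degree
        have h3 := natDegree_mul_le (p := C (n : ℝ) - X) (q := ∏ t ∈ T.erase z, (X - C (t : ℝ)))
        have h4 := card_erase_add_one hzT
        omega
      · intro y hy hyz
        rw [hev]
        simp only [mem_insert] at hy
        rcases hy with rfl | rfl | hy
        · simp
        · simp
        · rw [prod_eq_zero (mem_erase.mpr ⟨hyz, hy⟩) (sub_self _)]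
          simp
      · rw [hev]
        exact mul_pos (by exact_mod_cast (hTe.1 z hzT).1) hcz
      · intro j hjn
        rw [hev]
        rcases Nat.eq_zero_or_pos j with rfl | hj
        · simp
        · exact mul_nonneg (Nat.cast_nonneg j) (hc j hj hjn)

/-- The number of ones of a bit vector. -/
def weight {n : ℕ} (v : Fin n → Bool) : ℕ := #(univ.filter fun i => v i = true)

theorem weight_le {n : ℕ} (v : Fin n → Bool) : weight v ≤ n :=
  (card_le_univ _).trans (Fintype.card_fin n).le

theorem weight_true (n : ℕ) : weight (fun _ : Fin n => true) = n := by
  simp [weight]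

/-- The distribution whose weight at `v` is `w (weight v)`, summed over the vectors that are one
on `S`. -/
theorem sum_filter_weight {n : ℕ} (w : ℕ → ℝ) (S : Finset (Fin n)) :
    ∑ v ∈ univ.filter (fun v : Fin n → Bool => ∀ i ∈ S, v i = true), w (weight v) =
      ∑ j ∈ range (n - #S + 1), ((n - #S).choose j : ℝ) * w (#S + j) := by
  have hc : #(univ \ S) = n - #S := by rw [card_univ_sdiff, Fintype.card_fin]
  have := sum_powerset_apply_card (fun j => w (#S + j)) (x := univ \ S)
  rw [hc] at this
  simp only [nsmul_eq_mul] at this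
  rw [← this]
  refine sum_bij' (fun v _ => (univ.filter fun i => v i = true) \ S)
    (fun B _ i => decide (i ∈ S ∨ i ∈ B)) ?_ ?_ ?_ ?_ ?_
  · intro v _
    exact mem_powerset.mpr (sdiff_subset_sdiff (subset_univ _) le_rfl)
  · intro B _
    simp +contextual
  · intro v hv
    funext i
    have hv' := (mem_filter.mp hv).2 i
    by_cases hi : i ∈ S
    · simp [hi, hv' hi]
    · simp [hi]
  · intro B hB
    ext i
    have : i ∈ B → i ∈ univ \ S := fun h => mem_powerset.mp hB h
    simp only [mem_sdiff, mem_univ, true_and] at this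
    simp only [mem_sdiff, mem_filter, mem_univ, true_and, decide_eq_true_eq]
    tauto
  · intro v hv
    have hsub : S ⊆ univ.filter fun i => v i = true := fun i hi => by
      simpa using (mem_filter.mp hv).2 i hi
    congr 1
    rw [weight, add_comm, card_sdiff_add_card_eq_card hsub]

/-- The sum of `w (weight v)` over all `v`. -/
theorem sum_weight (n : ℕ) (w : ℕ → ℝ) :
    ∑ v : Fin n → Bool, w (weight v) = ∑ j ∈ range (n + 1), (n.choose j : ℝ) * w j := by
  simpa using sum_filter_weight w (∅ : Finset (Fin n))

theorem sum_filter_bernoulli {n : ℕ} (p : ℝ) (S : Finset (Fin n)) :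
    ∑ v ∈ univ.filter (fun v : Fin n → Bool => ∀ i ∈ S, v i = true),
      p ^ weight v * (1 - p) ^ (n - weight v) = p ^ #S := by
  rw [sum_filter_weight fun j => p ^ j * (1 - p) ^ (n - j)]
  have h := add_pow p (1 - p) (n - #S)
  rw [add_sub_cancel, one_pow] at h
  conv_rhs => rw [← mul_one (p ^ #S), h, mul_sum]
  refine sum_congr rfl fun j _ => ?_
  rw [pow_add, Nat.sub_add_eq]
  ring

/-- A weighting symmetric in the coordinates is described by its factorial moments. -/
theorem factorial_mul_sum_filter_weight {n : ℕ} (w : ℕ → ℝ) (S : Finset (Fin n)) :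
    ((#S).factorial * n.choose #S : ℝ) *
      ∑ v ∈ univ.filter (fun v : Fin n → Bool => ∀ i ∈ S, v i = true), w (weight v) =
      ∑ j ∈ range (n + 1), (n.choose j : ℝ) * w j * (descPochhammer ℝ #S).eval (j : ℝ) := by
  have hS : #S ≤ n := (card_le_univ S).trans (Fintype.card_fin n).le
  rw [sum_filter_weight, mul_sum]
  have hsplit : n + 1 = #S + (n - #S + 1) := by omega
  conv_rhs => rw [hsplit, sum_range_add]
  rw [sum_eq_zero (s := range #S), zero_add]
  · refine sum_congr rfl fun j _ => ?_
    rw [descPochhammer_eval_eq_descFactorial, Nat.descFactorial_eq_factorial_mul_choose]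
    have h := Nat.choose_mul (n := n) (k := #S + j) (s := #S) (by omega)
    rw [Nat.add_sub_cancel_left] at h
    have h' : (n.choose (#S + j) : ℝ) * (#S + j).choose #S = n.choose #S * (n - #S).choose j := by
      exact_mod_cast h
    push_cast
    linear_combination (-((#S).factorial : ℝ) * w (#S + j)) * h'
  · intro j hj
    rw [descPochhammer_eval_eq_descFactorial,
      Nat.descFactorial_eq_zero_iff_lt.mpr (mem_range.mp hj)]
    simp

theorem weight_pow {n : ℕ} (v : Fin n → Bool) (j : ℕ) :
    (weight v : ℝ) ^ j =
      ∑ τ : Fin j → Fin n, if ∀ i ∈ univ.image τ, v i = true then 1 else 0 := by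
  rw [← Finset.sum_filter, sum_const, nsmul_eq_mul, mul_one, ← Nat.cast_pow]
  congr 1
  rw [weight, ← Fintype.card_piFinset_const]
  congr 1
  ext τ
  simp [Fintype.mem_piFinset]

theorem sum_mul_weight_pow {n k : ℕ} {p : ℝ} {q : (Fin n → Bool) → ℝ}
    (hq : ∀ S : Finset (Fin n), #S ≤ k →
      ∑ v ∈ univ.filter (fun v : Fin n → Bool => ∀ i ∈ S, v i = true), q v = p ^ #S)
    {j : ℕ} (hj : j ≤ k) :
    ∑ v, q v * (weight v : ℝ) ^ j = ∑ τ : Fin j → Fin n, p ^ #(univ.image τ) := by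
  simp_rw [weight_pow, mul_sum]
  rw [sum_comm]
  refine sum_congr rfl fun τ _ => ?_
  rw [← hq _ ((card_image_le.trans (by simp)).trans hj), sum_filter]
  exact sum_congr rfl fun v _ => by rw [mul_ite, mul_one, mul_zero]

open Polynomial in
/-- Under a `k`-wise independent distribution, the number of ones has the moments of a binomial
variable up to order `k`. -/
theorem sum_mul_eval_weight {n k : ℕ} {p : ℝ} {q : (Fin n → Bool) → ℝ}
    (hq : ∀ S : Finset (Fin n), #S ≤ k →
      ∑ v ∈ univ.filter (fun v : Fin n → Bool => ∀ i ∈ S, v i = true), q v = p ^ #S)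
    {f : ℝ[X]} (hf : f.natDegree ≤ k) :
    ∑ v, q v * f.eval (weight v : ℝ) =
      ∑ j ∈ range (n + 1), (n.choose j * (p ^ j * (1 - p) ^ (n - j))) * f.eval (j : ℝ) := by
  have key : ∀ r : (Fin n → Bool) → ℝ, (∀ S : Finset (Fin n), #S ≤ k →
      ∑ v ∈ univ.filter (fun v : Fin n → Bool => ∀ i ∈ S, v i = true), r v = p ^ #S) →
      ∑ v, r v * f.eval (weight v : ℝ) =
        ∑ i ∈ range (k + 1), f.coeff i * ∑ τ : Fin i → Fin n, p ^ #(univ.image τ) := by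
    intro r hr
    simp_rw [eval_eq_sum_range' (Nat.lt_succ_of_le hf), mul_sum]
    rw [sum_comm]
    refine sum_congr rfl fun i hi => ?_
    rw [← mul_sum, ← sum_mul_weight_pow hr (Nat.lt_succ_iff.mp (mem_range.mp hi)), mul_sum]
    exact sum_congr rfl fun v _ => by ring
  rw [key q hq, ← key _ fun S _ => sum_filter_bernoulli p S,
    sum_weight n fun j => p ^ j * (1 - p) ^ (n - j) * f.eval (j : ℝ)]
  exact sum_congr rfl fun j _ => by ring

open Polynomial in
theorem sum_binomial_succ (N : ℕ) (p : ℝ) (h : ℝ[X]) :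
    ∑ j ∈ range (N + 1 + 1), ((N + 1).choose j * (p ^ j * (1 - p) ^ (N + 1 - j))) *
      (X * h).eval (j : ℝ) =
    (N + 1) * p * ∑ j ∈ range (N + 1), (N.choose j * (p ^ j * (1 - p) ^ (N - j))) *
      (h.comp (X + 1)).eval (j : ℝ) := by
  rw [sum_range_succ', mul_sum]
  simp only [eval_mul, eval_X, Nat.cast_zero, zero_mul, mul_zero, add_zero]
  refine sum_congr rfl fun j _ => ?_
  have hc : ((N : ℝ) + 1) * N.choose j = (N + 1).choose (j + 1) * (j + 1) := by
    exact_mod_cast Nat.add_one_mul_choose_eq N j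
  rw [Nat.add_sub_add_right]
  simp only [eval_comp, eval_add, eval_X, eval_one]
  push_cast
  rw [pow_succ]
  linear_combination (-(p ^ j * p * (1 - p) ^ (N - j)) * h.eval ((j : ℝ) + 1)) * hc

theorem andProbs_bddAbove (n k : ℕ) (p : ℝ) : BddAbove (andProbs n k p) := by
  refine ⟨1, ?_⟩
  rintro t ⟨q, hq, hq1, -, rfl⟩
  rw [← hq1]
  exact single_le_sum (fun v _ => hq v) (mem_univ _)

theorem pow_mem_andProbs (n k : ℕ) {p : ℝ} (hp0 : 0 ≤ p) (hp1 : p ≤ 1) :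
    p ^ n ∈ andProbs n k p := by
  have := sub_nonneg.mpr hp1
  refine ⟨fun v => p ^ weight v * (1 - p) ^ (n - weight v), fun v => by positivity, ?_,
    fun S _ => sum_filter_bernoulli p S, by simp [weight_true]⟩
  simpa using sum_filter_bernoulli p (∅ : Finset (Fin n))

theorem andProbs_eq_singleton {n k : ℕ} {p : ℝ} (hp0 : 0 ≤ p) (hp1 : p ≤ 1) (h : n ≤ k) :
    andProbs n k p = {p ^ n} := by
  refine Set.eq_singleton_iff_unique_mem.mpr ⟨pow_mem_andProbs n k hp0 hp1, ?_⟩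
  rintro t ⟨q, -, -, hq, rfl⟩
  have := hq univ (by simpa using h)
  rw [card_univ, Fintype.card_fin] at this
  rw [← this, sum_eq_single_of_mem (fun _ => true) (by simp)]
  intro v hv hne
  exact absurd (funext fun i => (mem_filter.mp hv).2 i (mem_univ i)) hne

/-- Conditioning on the first bit being one. -/
theorem div_mem_andProbs {n k : ℕ} {p t : ℝ} (hp0 : 0 < p) (ht : t ∈ andProbs (n + 1) (k + 1) p) :
    t / p ∈ andProbs n k p := by
  obtain ⟨q, hq0, -, hq, rfl⟩ := ht
  have hcond : ∀ S : Finset (Fin n), #S ≤ k →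
      ∑ u ∈ univ.filter (fun u : Fin n → Bool => ∀ i ∈ S, u i = true),
        q (Fin.cons true u) / p = p ^ #S := by
    intro S hS
    have h0 : (0 : Fin (n + 1)) ∉ S.map (Fin.succEmb n) := by
      simp [Fin.succ_ne_zero]
    have hcard : #(insert 0 (S.map (Fin.succEmb n))) = #S + 1 := by
      rw [card_insert_of_notMem h0, card_map]
    have h := hq (insert 0 (S.map (Fin.succEmb n))) (by omega)
    rw [hcard, sum_filter, ← (Fin.consEquiv fun _ => Bool).sum_comp, Fintype.sum_prod_type,
      Fintype.sum_bool] at h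
    simp only [Fin.consEquiv_apply, mem_insert, mem_map, forall_eq_or_imp, Fin.cons_zero,
      forall_exists_index, and_imp, forall_apply_eq_imp_iff₂, Fin.coe_succEmb, Fin.cons_succ,
      true_and, Bool.false_eq_true, false_and, if_false, sum_const_zero, add_zero] at h
    rw [← sum_div, sum_filter, div_eq_iff hp0.ne', ← pow_succ]
    exact h
  refine ⟨fun u => q (Fin.cons true u) / p, fun u => div_nonneg (hq0 _) hp0.le, ?_, hcond, ?_⟩
  · simpa using hcond ∅ (by simp)
  · congr 2
    funext i
    refine Fin.cases rfl (fun _ => rfl) i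

open Polynomial in
/-- For odd `2 * m + 1 ≤ N + 1`, some `(2 * m + 1)`-wise independent distribution on `N + 1` bits
does at least `p` times as well as all `2 * m`-wise independent distributions on `N` bits. -/
theorem exists_mem_andProbs_ge {N m : ℕ} {p : ℝ} (hp0 : 0 < p) (hp1 : p < 1) (hm : 2 * m ≤ N) :
    ∃ t ∈ andProbs (N + 1) (2 * m + 1) p, ∀ s ∈ andProbs N (2 * m) p, p * s ≤ t := by
  have h1p := sub_pos.mpr hp1
  obtain ⟨ν, T, hν0, hT, hcard, hν, hνn⟩ := exists_principal_representation
    (fun j => (N + 1).choose j * (p ^ j * (1 - p) ^ (N + 1 - j))) (fun j => by positivity)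
    (n := N + 1) (m := m) (by omega)
  have hchoose : ∀ j ∈ range (N + 1 + 1), ((N + 1).choose j : ℝ) ≠ 0 := fun j hj => by
    have := (Nat.choose_pos (Nat.lt_succ_iff.mp (mem_range.mp hj))).ne'
    exact_mod_cast this
  have hind : ∀ S : Finset (Fin (N + 1)), #S ≤ 2 * m + 1 →
      ∑ v ∈ univ.filter (fun v : Fin (N + 1) → Bool => ∀ i ∈ S, v i = true),
        ν (weight v) / (N + 1).choose (weight v) = p ^ #S := by
    intro S hS
    have hSn : #S ≤ N + 1 := (card_le_univ S).trans (Fintype.card_fin _).le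
    have hpos : ((#S).factorial * (N + 1).choose #S : ℝ) ≠ 0 := by
      exact_mod_cast (Nat.mul_pos (Nat.factorial_pos _) (Nat.choose_pos hSn)).ne'
    refine mul_left_cancel₀ hpos ?_
    rw [← sum_filter_bernoulli p S,
      factorial_mul_sum_filter_weight (fun j => ν j / (N + 1).choose j) S,
      factorial_mul_sum_filter_weight (fun j => p ^ j * (1 - p) ^ (N + 1 - j)) S,
      ← hν _ (by rw [descPochhammer_natDegree]; exact hS)]
    exact sum_congr rfl fun j hj => by rw [mul_div_cancel₀ _ (hchoose j hj)]
  refine ⟨ν (N + 1), ⟨fun v => ν (weight v) / (N + 1).choose (weight v),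
    fun v => div_nonneg (hν0 _) (Nat.cast_nonneg _), by simpa using hind ∅ (by simp), hind,
    by simp [weight_true]⟩, ?_⟩
  rintro s ⟨q, hq0, -, hq, rfl⟩
  set h : ℝ[X] := C ((((N + 1 : ℕ) : ℝ) * ∏ t ∈ T, (((N + 1 : ℕ) : ℝ) - t))⁻¹) *
    ∏ t ∈ T, (X - C (t : ℝ)) with hh
  have hnode : nodePoly (N + 1) T = X * h := by
    rw [nodePoly, hh]
    ring
  have hdeg : (h.comp (X + 1)).natDegree ≤ 2 * m := by
    rw [← C_1, natDegree_comp, natDegree_X_add_C, mul_one, ← hcard]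
    exact (natDegree_C_mul_le _ _).trans (natDegree_prod_X_sub_C_le T)
  have hcomp : ∀ j : ℕ, (nodePoly (N + 1) T).eval ((j + 1 : ℕ) : ℝ) =
      (j + 1) * (h.comp (X + 1)).eval (j : ℝ) := by
    intro j
    simp [hnode]
  have hnonneg : ∀ j ≤ N, 0 ≤ (h.comp (X + 1)).eval (j : ℝ) := by
    intro j hj
    have h1 := hT.nodePoly_nonneg (Nat.succ_le_succ hj)
    rw [Nat.succ_eq_add_one, hcomp] at h1
    exact nonneg_of_mul_nonneg_right h1 (by positivity)
  have hone : ((N : ℝ) + 1) * (h.comp (X + 1)).eval (N : ℝ) = 1 := by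
    rw [← hcomp]
    exact nodePoly_eval_self N.succ_pos fun t ht => (hT.1 t ht).2
  rw [hνn, hnode, sum_binomial_succ, ← sum_mul_eval_weight hq hdeg]
  have hle := single_le_sum (f := fun u => q u * (h.comp (X + 1)).eval (weight u : ℝ))
    (fun u _ => mul_nonneg (hq0 u) (hnonneg _ (weight_le u))) (mem_univ fun _ => true)
  simp only [weight_true] at hle
  calc p * q (fun _ => true)
      = (N + 1) * p * (q (fun _ => true) * (h.comp (X + 1)).eval (N : ℝ)) := by
        linear_combination (-(p * q fun _ => true)) * hone
    _ ≤ _ := mul_le_mul_of_nonneg_left hle (by positivity)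

theorem stmt13 (n k : ℕ) (p : ℝ) (hn : 0 < n) (hk : Odd k) (hp0 : 0 < p) (hp1 : p < 1) :
    sSup (andProbs n k p) = p * sSup (andProbs (n - 1) (k - 1) p) := by
  obtain ⟨m, rfl⟩ := hk
  obtain ⟨N, rfl⟩ := Nat.exists_eq_add_one.mpr hn
  rw [Nat.add_sub_cancel, Nat.add_sub_cancel]
  rcases le_or_gt (2 * m) N with hm | hm
  · refine le_antisymm ?_ ?_
    · refine csSup_le ⟨_, pow_mem_andProbs _ _ hp0.le hp1.le⟩ fun t ht => ?_
      rw [mul_comm, ← div_le_iff₀ hp0]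
      exact le_csSup (andProbs_bddAbove _ _ _) (div_mem_andProbs hp0 ht)
    · obtain ⟨t, ht, hts⟩ := exists_mem_andProbs_ge hp0 hp1 hm
      refine le_trans ?_ (le_csSup (andProbs_bddAbove _ _ _) ht)
      rw [mul_comm, ← le_div_iff₀ hp0]
      refine csSup_le ⟨_, pow_mem_andProbs _ _ hp0.le hp1.le⟩ fun s hs => ?_
      rw [le_div_iff₀ hp0, mul_comm]
      exact hts s hs
  · rw [andProbs_eq_singleton hp0.le hp1.le (by omega),
      andProbs_eq_singleton hp0.le hp1.le hm.le, csSup_singleton, csSup_singleton, pow_succ']
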